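/- arXiv:1903.01914 — 2 statements merged into one kernel-verified Lean document; each statement's English description precedes it below -/
import Mathlib

section
/- Let G : (0,1) → [0,1) be the Gauss map G(x) = {1/x} (fractional part of 1/x). Suppose γ, τ > 0 are such that DC(γ,τ) ∩ (0,1) has positive Lebesgue measure. Then the set RDC(γ,τ) of irrational α ∈ (0,1) such that Gⁿ(α) ∈ DC(γ,τ) for infinitely many n ∈ ℕ has full Lebesgue measure in (0,1). -/
open MeasureTheory

/-- Distance from a real number to the nearest integer. -/
noncomputable def intDist (t : ℝ) : ℝ := ⨅ m : ℤ, |t - (m : ℝ)|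

/-- The one-dimensional Diophantine set `DC(γ, τ)`. -/
def DC1 (γ τ : ℝ) : Set ℝ :=
  {α | ∀ k : ℤ, k ≠ 0 → γ⁻¹ * |(k : ℝ)| ^ (-τ) ≤ intDist (k * α)}

/-- The Gauss map `G(x) = {1/x}` (fractional part of the inverse). -/
noncomputable def gaussMap (x : ℝ) : ℝ := Int.fract x⁻¹

/-- The Gauss map preserves the irrational numbers of `(0,1)`. -/
theorem gaussMap_irrational_mem {x : ℝ} (hx : Irrational x) :
    Irrational (gaussMap x) ∧ gaussMap x ∈ Set.Ioo (0 : ℝ) 1 := by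
  have h : Irrational (gaussMap x) := by
    unfold gaussMap Int.fract
    exact hx.inv.sub_intCast _
  exact ⟨h, lt_of_le_of_ne (Int.fract_nonneg _) h.ne_zero.symm, Int.fract_lt_one _⟩

theorem gaussMap_iterate_irrational_mem {x : ℝ} (hx : Irrational x) (hx' : x ∈ Set.Ioo (0 : ℝ) 1)
    (n : ℕ) : Irrational (gaussMap^[n] x) ∧ gaussMap^[n] x ∈ Set.Ioo (0 : ℝ) 1 := by
  induction n with
  | zero => exact ⟨hx, hx'⟩
  | succ n ih =>
    rw [Function.iterate_succ_apply']
    exact gaussMap_irrational_mem ih.1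

/-- The inverse branch of the `n`-th iterate of the Gauss map through a given irrational point is
a Möbius map of determinant `±1` whose denominators `q' ≤ q` satisfy `n + 1 ≤ q + q'`. -/
theorem exists_gaussMap_inverse_branch {x : ℝ} (hx : Irrational x) (hx' : x ∈ Set.Ioo (0 : ℝ) 1)
    (n : ℕ) : ∃ p p' q q' : ℝ, 1 ≤ q ∧ 0 ≤ q' ∧ q' ≤ q ∧ (n : ℝ) + 1 ≤ q + q' ∧
      |p' * q - p * q'| = 1 ∧
      (∀ t ∈ Set.Ioo (0 : ℝ) 1, gaussMap^[n] ((p + p' * t) / (q + q' * t)) = t) ∧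
      (p + p' * gaussMap^[n] x) / (q + q' * gaussMap^[n] x) = x := by
  induction n with
  | zero => exact ⟨0, 1, 1, 0, by simp⟩
  | succ n ih =>
    obtain ⟨p, p', q, q', hq, hq', hqq, hn, hdet, hinv, hval⟩ := ih
    obtain ⟨-, hy0, hy1⟩ := gaussMap_iterate_irrational_mem hx hx' n
    set y := gaussMap^[n] x with hy
    have ha : (1 : ℝ) ≤ (⌊y⁻¹⌋ : ℤ) := by
      exact_mod_cast Int.le_floor.2 (by simpa using (one_le_inv₀ hy0).2 hy1.le)
    obtain ⟨a, ha_def⟩ : ∃ a : ℝ, a = (⌊y⁻¹⌋ : ℤ) := ⟨_, rfl⟩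
    rw [← ha_def] at ha
    have key : ∀ t : ℝ, 0 ≤ t → (p * a + p' + p * t) / (q * a + q' + q * t) =
        (p + p' * (a + t)⁻¹) / (q + q' * (a + t)⁻¹) := by
      intro t ht
      have h1 : a + t ≠ 0 := by positivity
      have h2 : q * a + q' + q * t ≠ 0 := by positivity
      have h3 : q + q' * (a + t)⁻¹ ≠ 0 := by positivity
      rw [div_eq_div_iff h2 h3]
      field_simp
      ring
    refine ⟨p * a + p', p, q * a + q', q, by nlinarith, by linarith, by nlinarith, ?_, ?_, ?_, ?_⟩
    · push_cast
      nlinarith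
    · rw [← hdet, ← abs_neg]
      congr 1
      ring
    · rintro t ⟨ht0, ht1⟩
      have hpos : 0 < a + t := by linarith
      rw [key t ht0.le, Function.iterate_succ_apply',
        hinv _ ⟨inv_pos.2 hpos, inv_lt_one_of_one_lt₀ (by linarith)⟩, gaussMap, inv_inv, ha_def,
        Int.fract_intCast_add, Int.fract_eq_self.2 ⟨ht0.le, ht1⟩]
    · rw [Function.iterate_succ_apply', ← hy]
      have hsum : a + gaussMap y = y⁻¹ := ha_def ▸ Int.floor_add_fract _
      rw [key (gaussMap y) (Int.fract_nonneg _), hsum, inv_inv, hval]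

/-- Difference of two values of a Möbius map. -/
theorem mobius_sub {p p' q q' s t : ℝ} (hs : q + q' * s ≠ 0) (ht : q + q' * t ≠ 0) :
    (p + p' * s) / (q + q' * s) - (p + p' * t) / (q + q' * t) =
      (p' * q - p * q') * (s - t) / ((q + q' * s) * (q + q' * t)) := by
  rw [div_sub_div _ _ hs ht]
  congr 1
  ring

/-- A map that shrinks distances by at most a factor `C` shrinks Lebesgue measure by at most `C`. -/
theorem volume_le_mul_volume_image {f : ℝ → ℝ} {S : Set ℝ} {C : NNReal}
    (h : ∀ s ∈ S, ∀ t ∈ S, |s - t| ≤ C * |f s - f t|) :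
    volume S ≤ C * volume (f '' S) := by
  have hinj : Set.InjOn f S := by
    intro s hs t ht hst
    have := h s hs t ht
    rw [hst, sub_self, abs_zero, mul_zero] at this
    exact sub_eq_zero.1 (abs_nonpos_iff.1 this)
  have hlip : LipschitzOnWith C (Function.invFunOn f S) (f '' S) := by
    refine LipschitzOnWith.of_dist_le_mul ?_
    rintro _ ⟨s, hs, rfl⟩ _ ⟨t, ht, rfl⟩
    rw [hinj.leftInvOn_invFunOn hs, hinj.leftInvOn_invFunOn ht]
    exact h s hs t ht
  have himage : Function.invFunOn f S '' (f '' S) = S := hinj.invFunOn_image subset_rfl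
  have := hlip.hausdorffMeasure_image_le (d := 1) zero_le_one
  rwa [himage, ENNReal.rpow_one, hausdorffMeasure_real] at this

/-- Every irrational point lies in a ball of radius at most `1 / (n + 1)` in which a uniform
proportion of points is mapped into `D` by the `n`-th iterate of the Gauss map. -/
theorem exists_closedBall_volume_gaussMap_preimage_ge {x : ℝ} (hx : Irrational x)
    (hx' : x ∈ Set.Ioo (0 : ℝ) 1) (D : Set ℝ) (n : ℕ) :
    ∃ c r : ℝ, 0 < r ∧ r ≤ 1 / ((n : ℝ) + 1) ∧ x ∈ Metric.closedBall c r ∧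
      volume (D ∩ Set.Ioo (0 : ℝ) 1) / 4 * volume (Metric.closedBall c r) ≤
        volume (Metric.closedBall c r ∩ gaussMap^[n] ⁻¹' D) := by
  obtain ⟨p, p', q, q', hq, hq', hqq, hn, hdet, hinv, hval⟩ :=
    exists_gaussMap_inverse_branch hx hx' n
  have hq0 : 0 < q := by linarith
  have hQ0 : 0 < q + q' := by linarith
  set f : ℝ → ℝ := fun t => (p + p' * t) / (q + q' * t) with hf
  have hden : ∀ t ∈ Set.Ioo (0 : ℝ) 1, 0 < q + q' * t ∧ q + q' * t ≤ q + q' := by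
    rintro t ⟨h0, h1⟩
    exact ⟨by positivity, by nlinarith⟩
  have hball : ∀ t ∈ Set.Ioo (0 : ℝ) 1,
      f t ∈ Metric.closedBall (p / q) (1 / (q * (q + q'))) := by
    rintro t ht
    have hd := (hden t ht).1
    have h := mobius_sub (p := p) (p' := p') (q := q) (q' := q') (s := t) (t := 0)
      hd.ne' (by simpa using hq0.ne')
    simp only [mul_zero, add_zero, sub_zero] at h
    rw [Metric.mem_closedBall, Real.dist_eq, hf]
    dsimp only
    rw [h, abs_div, abs_mul, hdet, one_mul, abs_of_pos ht.1, abs_of_pos (by positivity),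
      div_le_div_iff₀ (by positivity) (by positivity)]
    have : t * (q + q') ≤ q + q' * t := by nlinarith [ht.2]
    nlinarith
  refine ⟨p / q, 1 / (q * (q + q')), by positivity, ?_, ?_, ?_⟩
  · apply one_div_le_one_div_of_le (by positivity)
    nlinarith
  · have := hball _ (gaussMap_iterate_irrational_mem hx hx' n).2
    rwa [hf, show (fun t => (p + p' * t) / (q + q' * t)) (gaussMap^[n] x) = x from hval] at this
  · have hexp : ∀ s ∈ D ∩ Set.Ioo (0 : ℝ) 1, ∀ t ∈ D ∩ Set.Ioo (0 : ℝ) 1,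
        |s - t| ≤ (((q + q') ^ 2).toNNReal : ℝ) * |f s - f t| := by
      rintro s ⟨-, hs⟩ t ⟨-, ht⟩
      obtain ⟨hs0, hs1⟩ := hden s hs
      obtain ⟨ht0, ht1⟩ := hden t ht
      rw [Real.coe_toNNReal _ (by positivity), hf]
      dsimp only
      rw [mobius_sub hs0.ne' ht0.ne', abs_div, abs_mul, hdet, one_mul,
        abs_of_pos (mul_pos hs0 ht0), ← mul_div_assoc, le_div_iff₀ (mul_pos hs0 ht0), mul_comm]
      have : (q + q' * s) * (q + q' * t) ≤ (q + q') ^ 2 := by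
        rw [sq]
        exact mul_le_mul hs1 ht1 ht0.le hQ0.le
      exact mul_le_mul_of_nonneg_right this (abs_nonneg _)
    have himage : f '' (D ∩ Set.Ioo (0 : ℝ) 1) ⊆
        Metric.closedBall (p / q) (1 / (q * (q + q'))) ∩ gaussMap^[n] ⁻¹' D := by
      rintro _ ⟨t, ⟨htD, ht⟩, rfl⟩
      refine ⟨hball t ht, ?_⟩
      rw [Set.mem_preimage, hinv t ht]
      exact htD
    set T := Metric.closedBall (p / q) (1 / (q * (q + q'))) ∩ gaussMap^[n] ⁻¹' D
    have hvol : volume (D ∩ Set.Ioo (0 : ℝ) 1) ≤ ENNReal.ofReal ((q + q') ^ 2) * volume T :=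
      (volume_le_mul_volume_image hexp).trans (by gcongr; exact le_rfl)
    have hconst : ENNReal.ofReal ((q + q') ^ 2) * 4⁻¹ *
        ENNReal.ofReal (2 * (1 / (q * (q + q')))) ≤ 1 := by
      rw [show (4⁻¹ : ENNReal) = ENNReal.ofReal 4⁻¹ by
        rw [ENNReal.ofReal_inv_of_pos (by norm_num)]; norm_num,
        ← ENNReal.ofReal_mul (by positivity), ← ENNReal.ofReal_mul (by positivity),
        ENNReal.ofReal_le_one]
      field_simp
      nlinarith
    rw [Real.volume_closedBall, div_eq_mul_inv]
    calc _ ≤ ENNReal.ofReal ((q + q') ^ 2) * volume T * 4⁻¹ *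
          ENNReal.ofReal (2 * (1 / (q * (q + q')))) := by gcongr
      _ = ENNReal.ofReal ((q + q') ^ 2) * 4⁻¹ *
          ENNReal.ofReal (2 * (1 / (q * (q + q')))) * volume T := by ring
      _ ≤ 1 * volume T := by gcongr
      _ = volume T := one_mul _

theorem measurable_gaussMap : Measurable gaussMap :=
  measurable_fract.comp measurable_inv

theorem measurable_intDist : Measurable intDist := by
  unfold intDist
  refine Measurable.iInf fun m => ?_
  fun_prop

theorem measurableSet_DC1 (γ τ : ℝ) : MeasurableSet (DC1 γ τ) := by
  have : DC1 γ τ = ⋂ k : ℤ, ⋂ _ : k ≠ 0,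
      {α : ℝ | γ⁻¹ * |(k : ℝ)| ^ (-τ) ≤ intDist (k * α)} := by
    ext α
    simp [DC1]
  rw [this]
  refine MeasurableSet.iInter fun k => MeasurableSet.iInter fun _ => ?_
  exact measurableSet_le measurable_const (measurable_intDist.comp (measurable_const_mul _))

/-- Almost no irrational point has a Gauss orbit that avoids, from time `N` on, a measurable set
of positive measure. -/
theorem volume_gaussMap_eventually_avoiding {D : Set ℝ} (hD : MeasurableSet D)
    (hpos : 0 < volume (D ∩ Set.Ioo (0 : ℝ) 1)) (N : ℕ) :
    volume {x : ℝ | (Irrational x ∧ x ∈ Set.Ioo (0 : ℝ) 1) ∧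
      ∀ n ≥ N, gaussMap^[n] x ∉ D} = 0 := by
  set B : Set ℝ := {x : ℝ | (Irrational x ∧ x ∈ Set.Ioo (0 : ℝ) 1) ∧
    ∀ n ≥ N, gaussMap^[n] x ∉ D} with hB
  have hpre : ∀ n, MeasurableSet (gaussMap^[n] ⁻¹' D) := fun n =>
    measurable_gaussMap.iterate n hD
  have hBmeas : MeasurableSet B := by
    have : B = ({x | Irrational x} ∩ Set.Ioo 0 1) ∩
        ⋂ n : ℕ, ⋂ _ : n ≥ N, (gaussMap^[n] ⁻¹' D)ᶜ := by
      ext x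
      simp [hB]
    rw [this]
    have hirr : MeasurableSet {x : ℝ | Irrational x} :=
      (Set.countable_range ((↑) : ℚ → ℝ)).measurableSet.compl
    exact (hirr.inter measurableSet_Ioo).inter
      (MeasurableSet.iInter fun n => MeasurableSet.iInter fun _ => (hpre n).compl)
  set v := volume (D ∩ Set.Ioo (0 : ℝ) 1)
  rw [← Measure.restrict_eq_zero, ← ae_eq_bot, ← Filter.eventually_false_iff_eq_bot]
  filter_upwards [IsUnifLocDoublingMeasure.ae_tendsto_measure_inter_div (volume : Measure ℝ) B 1,
    ae_restrict_mem hBmeas] with x hdens hxB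
  choose c r hr0 hr hxc hvol using
    exists_closedBall_volume_gaussMap_preimage_ge hxB.1.1 hxB.1.2 D
  have hrlim : Filter.Tendsto r Filter.atTop (nhdsWithin 0 (Set.Ioi 0)) :=
    tendsto_nhdsWithin_iff.2 ⟨squeeze_zero (fun n => (hr0 n).le) hr
      tendsto_one_div_add_atTop_nhds_zero_nat, Filter.Eventually.of_forall hr0⟩
  have hlim := hdens c r hrlim (Filter.Eventually.of_forall fun n => by
    simpa only [one_mul] using hxc n)
  have hle : ∀ᶠ n in Filter.atTop, volume (B ∩ Metric.closedBall (c n) (r n)) /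
      volume (Metric.closedBall (c n) (r n)) + v / 4 ≤ 1 := by
    filter_upwards [Filter.eventually_ge_atTop N] with n hn
    set K := Metric.closedBall (c n) (r n) with hK
    have hK0 : volume K ≠ 0 := by
      rw [hK, Real.volume_closedBall]
      simpa using hr0 n
    have hKtop : volume K ≠ ⊤ := measure_closedBall_lt_top.ne
    rw [← ENNReal.mul_div_cancel_right (a := v / 4) hK0 hKtop, ENNReal.div_add_div_same]
    refine ENNReal.div_le_of_le_mul ?_
    rw [one_mul, add_comm]
    refine (add_le_add (hvol n) (measure_mono ?_)).trans
      (measure_inter_add_sdiff K (hpre n)).le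
    rintro y ⟨hyB, hyK⟩
    exact ⟨hyK, hyB.2 n hn⟩
  have h1 : 1 + v / 4 ≤ 1 := le_of_tendsto (hlim.add_const _) hle
  have hv4 : 0 < v / 4 := ENNReal.div_pos hpos.ne' (by norm_num)
  exact absurd h1 (not_le.2 (ENNReal.lt_add_right ENNReal.one_ne_top hv4.ne'))

/-- If `DC(γ,τ) ∩ (0,1)` has positive Lebesgue measure, then the set `RDC(γ,τ)` of
irrational `α ∈ (0,1)` whose Gauss-map orbit visits `DC(γ,τ)` infinitely often has
full Lebesgue measure in `(0,1)`. -/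
theorem stmt4 (γ τ : ℝ) (hγ : 0 < γ) (hτ : 0 < τ)
    (hpos : 0 < volume (DC1 γ τ ∩ Set.Ioo (0 : ℝ) 1)) :
    volume (Set.Ioo (0 : ℝ) 1 \
      {α : ℝ | Irrational α ∧ ∃ᶠ n in Filter.atTop, gaussMap^[n] α ∈ DC1 γ τ}) = 0 := by
  have hrat : volume {x : ℝ | ¬ Irrational x} = 0 := by
    have : {x : ℝ | ¬ Irrational x} = Set.range ((↑) : ℚ → ℝ) := by
      ext x
      simp [Irrational]
    rw [this]
    exact (Set.countable_range _).measure_zero _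
  refine measure_mono_null ?_ (measure_union_null hrat (measure_iUnion_null fun N =>
    volume_gaussMap_eventually_avoiding (measurableSet_DC1 γ τ) hpos N))
  rintro x ⟨hx, hxR⟩
  by_cases hirr : Irrational x
  · right
    have : ∀ᶠ n in Filter.atTop, gaussMap^[n] x ∉ DC1 γ τ := by
      by_contra h
      exact hxR ⟨hirr, h⟩
    obtain ⟨N, hN⟩ := Filter.eventually_atTop.1 this
    exact Set.mem_iUnion.2 ⟨N, ⟨hirr, hx⟩, hN⟩
  · exact Or.inl hirr
end

section
/- Let d ≥ 1, γ, τ > 0, and let α ∈ ℝ^d belong to DC(γ,τ). Let f : ℝ^d → ℂ be a C^∞, ℤ^d-periodic function with ∫_{[0,1]^d} f(x) dx = 0. Then there exists a C^∞, ℤ^d-periodic function φ : ℝ^d → ℂ such that φ(x+α) − φ(x) = f(x) for all x ∈ ℝ^d. -/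
open MeasureTheory

/-- Dot product of an integer vector with a real vector. -/
noncomputable def dotZ {d : ℕ} (k : Fin d → ℤ) (α : Fin d → ℝ) : ℝ :=
  ∑ i, (k i : ℝ) * α i

/-- The Diophantine set `DC(γ, τ)`. -/
def DC (d : ℕ) (γ τ : ℝ) : Set (Fin d → ℝ) :=
  {α | ∀ k : Fin d → ℤ, k ≠ 0 → γ⁻¹ * ‖k‖ ^ (-τ) ≤ intDist (dotZ k α)}

open Set Filter Topology UnitAddTorus

/-- The measure on `ℝ / ℤ` is normalised to have total volume 1. -/
noncomputable local instance : MeasureSpace UnitAddCircle := ⟨AddCircle.haarAddCircle⟩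

local instance : Measure.IsAddHaarMeasure (volume : Measure UnitAddCircle) :=
  inferInstanceAs (Measure.IsAddHaarMeasure AddCircle.haarAddCircle)

local instance : IsProbabilityMeasure (volume : Measure UnitAddCircle) :=
  inferInstanceAs (IsProbabilityMeasure AddCircle.haarAddCircle)

/-- A function on `ℝ^d` is `ℤ^d`-periodic. -/
def ZPeriodic {d : ℕ} {E : Type*} (f : (Fin d → ℝ) → E) : Prop :=
  ∀ (x : Fin d → ℝ) (k : Fin d → ℤ), f (x + fun i => (k i : ℝ)) = f x

/-- The half-open unit cube. -/
def unitCube (d : ℕ) : Set (Fin d → ℝ) := {x | ∀ i, x i ∈ Ioc (0 : ℝ) (0 + 1)}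

/-- The function on the torus induced by the values of `f` on the half-open unit cube. -/
noncomputable def torusLift {d : ℕ} {E : Type*} (f : (Fin d → ℝ) → E) (y : UnitAddTorus (Fin d)) :
    E :=
  f fun i => (AddCircle.equivIoc 1 0 (y i)).1

/-- The projection of `ℝ^d` onto the torus. -/
def torusMk {d : ℕ} (x : Fin d → ℝ) : UnitAddTorus (Fin d) := fun i => (x i : UnitAddCircle)

/-- The character `x ↦ exp (2πi n·x)`. -/
noncomputable def torusChar {d : ℕ} (n : Fin d → ℤ) (x : Fin d → ℝ) : ℂ :=
  Complex.exp (2 * Real.pi * Complex.I * dotZ n x)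

/-- The `n`-th Fourier coefficient of `f`. -/
noncomputable def cubeCoeff {d : ℕ} (f : (Fin d → ℝ) → ℂ) (n : Fin d → ℤ) : ℂ :=
  ∫ x in unitCube d, torusChar (-n) x * f x

/-- The linear form `x ↦ n·x`. -/
noncomputable def dotCLM {d : ℕ} (n : Fin d → ℤ) : (Fin d → ℝ) →L[ℝ] ℝ :=
  ∑ i, (n i : ℝ) • ContinuousLinearMap.proj i

lemma dotCLM_apply {d : ℕ} (n : Fin d → ℤ) (x : Fin d → ℝ) : dotCLM n x = dotZ n x := by
  simp [dotCLM, dotZ]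

lemma norm_dotCLM_le {d : ℕ} (n : Fin d → ℤ) : ‖dotCLM n‖ ≤ d * ‖n‖ := by
  refine ContinuousLinearMap.opNorm_le_bound _ (by positivity) fun x => ?_
  rw [dotCLM_apply, dotZ]
  refine (norm_sum_le _ _).trans ?_
  have : ∀ i ∈ Finset.univ, ‖(n i : ℝ) * x i‖ ≤ ‖n‖ * ‖x‖ := fun i _ => by
    rw [norm_mul]
    gcongr
    · exact (Int.norm_cast_real _).trans_le (norm_le_pi_norm n i)
    · exact norm_le_pi_norm x i
  simpa [mul_assoc] using Finset.sum_le_sum this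

lemma unitCube_eq (d : ℕ) : unitCube d = Set.pi univ fun _ => Ioc (0 : ℝ) 1 := by
  ext x; simp [unitCube]

lemma measurableSet_unitCube (d : ℕ) : MeasurableSet (unitCube d) := by
  rw [unitCube_eq]
  exact MeasurableSet.univ_pi fun _ => measurableSet_Ioc

lemma unitCube_subset_Icc (d : ℕ) : unitCube d ⊆ Icc 0 1 := fun x hx =>
  ⟨fun i => (hx i).1.le, fun i => by simpa using (hx i).2⟩

lemma unitCube_ae_eq_Icc (d : ℕ) : unitCube d =ᵐ[volume] Icc (0 : Fin d → ℝ) 1 := by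
  rw [unitCube_eq]
  exact Measure.univ_pi_Ioc_ae_eq_Icc

instance isFiniteMeasure_restrict_unitCube (d : ℕ) :
    IsFiniteMeasure ((volume : Measure (Fin d → ℝ)).restrict (unitCube d)) := by
  refine ⟨?_⟩
  rw [Measure.restrict_apply_univ]
  exact (measure_mono (unitCube_subset_Icc d)).trans_lt isCompact_Icc.measure_lt_top

lemma integrableOn_unitCube {d : ℕ} {f : (Fin d → ℝ) → ℂ} (hf : Continuous f) :
    IntegrableOn f (unitCube d) :=
  (hf.continuousOn.integrableOn_compact isCompact_Icc).mono_set (unitCube_subset_Icc d)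

lemma torusLift_torusMk {d : ℕ} {E : Type*} {f : (Fin d → ℝ) → E} (hf : ZPeriodic f)
    (x : Fin d → ℝ) : torusLift f (torusMk x) = f x := by
  have h : ∀ i, ∃ k : ℤ, (AddCircle.equivIoc 1 0 (x i : UnitAddCircle)).1 = x i + k := fun i => by
    have h1 : ((AddCircle.equivIoc 1 0 (x i : UnitAddCircle)).1 : UnitAddCircle) = x i :=
      (AddCircle.equivIoc (1 : ℝ) 0).symm_apply_apply _
    rw [← sub_eq_zero, ← AddCircle.coe_sub, AddCircle.coe_eq_zero_iff] at h1
    obtain ⟨k, hk⟩ := h1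
    exact ⟨k, by simp at hk; linarith⟩
  choose k hk using h
  rw [torusLift, ← hf x k]
  congr 1
  ext i
  exact hk i

lemma continuous_torusLift {d : ℕ} {f : (Fin d → ℝ) → ℂ} (hf : Continuous f)
    (hp : ZPeriodic f) : Continuous (torusLift f) := by
  have hq : IsOpenQuotientMap (torusMk : (Fin d → ℝ) → UnitAddTorus (Fin d)) :=
    IsOpenQuotientMap.piMap fun _ => QuotientAddGroup.isOpenQuotientMap_mk
  rw [← hq.isQuotientMap.continuous_iff.symm]
  exact hf.congr fun x => (torusLift_torusMk hp x).symm

lemma integral_torusLift {d : ℕ} {f : (Fin d → ℝ) → ℂ} (hp : ZPeriodic f) :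
    ∫ y, torusLift f y = ∫ x in unitCube d, f x := by
  rw [integral_preimage _ (0 : Fin d → ℝ)]
  exact integral_congr_ae (.of_forall fun x => torusLift_torusMk hp x)

lemma ZPeriodic.comp_add_right {d : ℕ} {E : Type*} {f : (Fin d → ℝ) → E} (hp : ZPeriodic f)
    (v : Fin d → ℝ) : ZPeriodic fun x => f (x + v) := fun x k => by
  simp only [add_right_comm x _ v, hp (x + v) k]

lemma integral_unitCube_comp_add {d : ℕ} {f : (Fin d → ℝ) → ℂ} (hp : ZPeriodic f)
    (v : Fin d → ℝ) : ∫ x in unitCube d, f (x + v) = ∫ x in unitCube d, f x := by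
  rw [← integral_torusLift hp, ← integral_torusLift (hp.comp_add_right v),
    ← integral_add_right_eq_self (torusLift f) (torusMk v)]
  congr 1
  ext y
  obtain ⟨x, rfl⟩ : ∃ x, torusMk x = y :=
    ⟨fun i => (AddCircle.equivIoc 1 0 (y i)).1,
      funext fun i => (AddCircle.equivIoc (1 : ℝ) 0).symm_apply_apply _⟩
  rw [torusLift_torusMk (hp.comp_add_right v)]
  exact (torusLift_torusMk hp (x + v)).symm

lemma integral_unitCube_fderiv {d : ℕ} {f : (Fin d → ℝ) → ℂ} (hf : ContDiff ℝ 1 f)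
    (hp : ZPeriodic f) (v : Fin d → ℝ) : ∫ x in unitCube d, fderiv ℝ f x v = 0 := by
  have hc : Continuous fun x => fderiv ℝ f x v :=
    (hf.continuous_fderiv one_ne_zero).clm_apply continuous_const
  have hcomp : IsCompact ((fun q : ℝ × (Fin d → ℝ) => q.2 + q.1 • v) ''
      (Icc (-1) 1 ×ˢ Icc 0 1)) :=
    (isCompact_Icc.prod isCompact_Icc).image (by fun_prop)
  obtain ⟨C, hC⟩ := hcomp.exists_bound_of_continuousOn hc.continuousOn
  have key := (hasDerivAt_integral_of_dominated_loc_of_deriv_le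
    (μ := volume.restrict (unitCube d)) (𝕜 := ℝ) (F := fun t x => f (x + t • v))
    (F' := fun t x => fderiv ℝ f (x + t • v) v) (x₀ := 0) (s := Icc (-1) 1)
    (bound := fun _ => C)
    (Icc_mem_nhds (by norm_num) (by norm_num))
    (.of_forall fun t => (hf.continuous.comp (by fun_prop)).aestronglyMeasurable)
    (integrableOn_unitCube (hf.continuous.comp (by fun_prop)))
    (hc.comp (by fun_prop : Continuous fun x : Fin d → ℝ => x + (0 : ℝ) • v)).aestronglyMeasurable
    ((ae_restrict_iff' (measurableSet_unitCube d)).2 (.of_forall fun x hx t ht =>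
      hC _ ⟨(t, x), ⟨ht, unitCube_subset_Icc d hx⟩, rfl⟩))
    (integrable_const C)
    (.of_forall fun x t _ => by
      have h1 : HasDerivAt (fun t : ℝ => x + t • v) v t := by
        simpa using ((hasDerivAt_id t).smul_const v).const_add x
      exact ((hf.differentiable one_ne_zero) _).hasFDerivAt.comp_hasDerivAt t h1)).2
  simp only [integral_unitCube_comp_add hp, zero_smul, add_zero] at key
  exact key.unique (hasDerivAt_const _ _)

lemma dotZ_add {d : ℕ} (n : Fin d → ℤ) (x y : Fin d → ℝ) :
    dotZ n (x + y) = dotZ n x + dotZ n y := by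
  simp [← dotCLM_apply]

lemma torusChar_add {d : ℕ} (n : Fin d → ℤ) (x y : Fin d → ℝ) :
    torusChar n (x + y) = torusChar n x * torusChar n y := by
  rw [torusChar, dotZ_add, torusChar, torusChar, ← Complex.exp_add]
  push_cast
  ring_nf

lemma torusChar_intCast {d : ℕ} (n k : Fin d → ℤ) :
    torusChar n (fun i => (k i : ℝ)) = 1 := by
  rw [torusChar, Complex.exp_eq_one_iff]
  refine ⟨∑ i, n i * k i, ?_⟩
  simp [dotZ]
  ring

lemma torusChar_periodic {d : ℕ} (n : Fin d → ℤ) : ZPeriodic (torusChar n) := fun x k => by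
  rw [torusChar_add, torusChar_intCast, mul_one]

lemma norm_torusChar {d : ℕ} (n : Fin d → ℤ) (x : Fin d → ℝ) : ‖torusChar n x‖ = 1 := by
  rw [torusChar, show (2 * Real.pi * Complex.I * dotZ n x : ℂ)
    = ((2 * Real.pi * dotZ n x : ℝ) : ℂ) * Complex.I by push_cast; ring]
  exact Complex.norm_exp_ofReal_mul_I _

lemma torusChar_eq_comp {d : ℕ} (n : Fin d → ℤ) :
    torusChar n = (fun t : ℝ => Complex.exp (2 * Real.pi * Complex.I * t)) ∘ dotCLM n := by
  ext x
  simp [torusChar, dotCLM_apply]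

lemma contDiff_torusChar {d : ℕ} (n : Fin d → ℤ) {m : WithTop ℕ∞} :
    ContDiff ℝ m (torusChar n) := by
  rw [torusChar_eq_comp]
  refine ContDiff.comp ?_ (dotCLM n).contDiff
  exact (contDiff_const.mul Complex.ofRealCLM.contDiff).cexp

lemma fderiv_torusChar_apply {d : ℕ} (n : Fin d → ℤ) (x v : Fin d → ℝ) :
    fderiv ℝ (torusChar n) x v = 2 * Real.pi * Complex.I * dotZ n v * torusChar n x := by
  have h1 : HasDerivAt (fun t : ℝ => Complex.exp (2 * Real.pi * Complex.I * t))
      (Complex.exp (2 * Real.pi * Complex.I * (dotCLM n x : ℝ)) *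
        (2 * Real.pi * Complex.I * 1)) (dotCLM n x) :=
    ((hasDerivAt_id _).ofReal_comp.const_mul _).cexp
  have h2 := h1.hasFDerivAt.comp x (dotCLM n).hasFDerivAt
  rw [torusChar_eq_comp, h2.fderiv]
  simp [dotCLM_apply]
  ring

lemma iteratedDeriv_exp_ofReal (c : ℂ) (k : ℕ) :
    iteratedDeriv k (fun t : ℝ => Complex.exp (c * t)) =
      fun t : ℝ => c ^ k * Complex.exp (c * t) := by
  induction k with
  | zero => simp
  | succ k ih =>
    rw [iteratedDeriv_succ, ih]
    ext t
    have h : HasDerivAt (fun t : ℝ => c ^ k * Complex.exp (c * t))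
        (c ^ k * (Complex.exp (c * t) * (c * 1))) t :=
      (((hasDerivAt_id t).ofReal_comp.const_mul c).cexp).const_mul _
    rw [h.deriv]
    ring

lemma norm_iteratedFDeriv_torusChar_le {d : ℕ} (n : Fin d → ℤ) (k : ℕ) (x : Fin d → ℝ) :
    ‖iteratedFDeriv ℝ k (torusChar n) x‖ ≤ (2 * Real.pi * d) ^ k * ‖n‖ ^ k := by
  have hsm : ContDiff ℝ k fun t : ℝ => Complex.exp (2 * Real.pi * Complex.I * t) :=
    (contDiff_const.mul Complex.ofRealCLM.contDiff).cexp
  have h1 : ‖iteratedFDeriv ℝ k (fun t : ℝ => Complex.exp (2 * Real.pi * Complex.I * t))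
      (dotCLM n x)‖ = (2 * Real.pi) ^ k := by
    have h2 := norm_torusChar n x
    rw [torusChar, ← dotCLM_apply] at h2
    rw [norm_iteratedFDeriv_eq_norm_iteratedDeriv, iteratedDeriv_exp_ofReal, norm_mul, h2]
    simp [abs_of_pos Real.pi_pos]
  rw [torusChar_eq_comp, (dotCLM n).iteratedFDeriv_comp_right hsm x le_rfl]
  refine (ContinuousMultilinearMap.norm_compContinuousLinearMap_le _ _).trans ?_
  rw [h1, Finset.prod_const, Finset.card_univ, Fintype.card_fin, ← mul_pow, ← mul_pow]
  have := Real.pi_pos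
  refine pow_le_pow_left₀ (by positivity) ?_ k
  rw [mul_assoc (2 * Real.pi)]
  gcongr
  exact norm_dotCLM_le n

lemma summable_norm_inv_pow (d : ℕ) :
    ∃ N : ℕ, Summable fun n : Fin d → ℤ => ‖n‖⁻¹ ^ N := by
  let b := Pi.basisFun ℝ (Fin d)
  let L := Submodule.span ℤ (Set.range b)
  refine ⟨Module.finrank ℤ L + 1, ?_⟩
  have h := ZLattice.summable_norm_pow_inv L (Module.finrank ℤ L + 1) (Nat.lt_succ_self _)
  have hmem : ∀ n : Fin d → ℤ, (fun i => (n i : ℝ)) ∈ L := fun n => by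
    have h1 : (fun i => (n i : ℝ)) = ∑ i, n i • b i := by
      ext j
      simp [b, Pi.single_apply]
    rw [h1]
    exact Submodule.sum_mem _ fun i _ =>
      Submodule.smul_mem _ _ (Submodule.subset_span (mem_range_self i))
  have := h.comp_injective (i := fun n : Fin d → ℤ => (⟨fun i => (n i : ℝ), hmem n⟩ : L))
    fun m n hmn => by
      ext i
      simpa using congrFun (congrArg Subtype.val hmn) i
  refine this.congr fun n => ?_
  have : ‖fun i => (n i : ℝ)‖ = ‖n‖ := by
    have h1 : ∀ m : ℤ, ‖(m : ℝ)‖₊ = ‖m‖₊ := fun m => NNReal.eq (Int.norm_cast_real m)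
    simp only [Pi.norm_def, h1]
  simp [this]

lemma ZPeriodic.fderiv_apply {d : ℕ} {f : (Fin d → ℝ) → ℂ} (hp : ZPeriodic f)
    (v : Fin d → ℝ) : ZPeriodic fun x => fderiv ℝ f x v := fun x k => by
  have h : (fun y => f (y + fun i => (k i : ℝ))) = f := funext fun y => hp y k
  simp only [← fderiv_comp_add_right, h]

lemma cubeCoeff_fderiv {d : ℕ} {f : (Fin d → ℝ) → ℂ} (hf : ContDiff ℝ 1 f)
    (hp : ZPeriodic f) (n : Fin d → ℤ) (v : Fin d → ℝ) :
    cubeCoeff (fun x => fderiv ℝ f x v) n =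
      2 * Real.pi * Complex.I * dotZ n v * cubeCoeff f n := by
  have hneg : dotZ (-n) v = -dotZ n v := by simp [dotZ]
  have h0 := integral_unitCube_fderiv (f := fun x => torusChar (-n) x * f x)
    ((contDiff_torusChar (-n)).mul hf)
    (fun x k => by simp only [torusChar_periodic (-n) x k, hp x k]) v
  have h1 : ∀ x, fderiv ℝ (fun x => torusChar (-n) x * f x) x v =
      torusChar (-n) x * fderiv ℝ f x v
        - 2 * Real.pi * Complex.I * dotZ n v * (torusChar (-n) x * f x) := fun x => by
    rw [fderiv_fun_mul ((contDiff_torusChar (-n) (m := 1)).differentiable one_ne_zero x)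
      (hf.differentiable one_ne_zero x)]
    simp [fderiv_torusChar_apply, hneg]
    ring
  have hch : Continuous (torusChar (-n)) := (contDiff_torusChar (-n) (m := 0)).continuous
  simp only [h1] at h0
  rw [integral_sub, integral_const_mul, sub_eq_zero] at h0
  · exact h0
  · exact integrableOn_unitCube (hch.mul
      ((hf.continuous_fderiv one_ne_zero).clm_apply continuous_const))
  · exact (integrableOn_unitCube (hch.mul hf.continuous)).const_mul _

lemma exists_abs_pow_mul_norm_cubeCoeff_le {d : ℕ} (i : Fin d) (N : ℕ) :
    ∀ f : (Fin d → ℝ) → ℂ, ContDiff ℝ (⊤ : ℕ∞) f → ZPeriodic f →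
      ∃ C, ∀ n : Fin d → ℤ, ‖n i‖ ^ N * ‖cubeCoeff f n‖ ≤ C := by
  induction N with
  | zero =>
    refine fun f _ _ => ⟨∫ x in unitCube d, ‖f x‖, fun n => ?_⟩
    rw [pow_zero, one_mul]
    refine (norm_integral_le_integral_norm _).trans_eq ?_
    simp [norm_torusChar]
  | succ N ih =>
    intro f hf hp
    have hf' : ContDiff ℝ (⊤ : ℕ∞) fun x => fderiv ℝ f x (Pi.single i 1) :=
      (hf.fderiv_right (m := (⊤ : ℕ∞)) (by simp)).clm_apply contDiff_const
    obtain ⟨C, hC⟩ := ih _ hf' (hp.fderiv_apply _)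
    refine ⟨C, fun n => le_trans ?_ (hC n)⟩
    rw [cubeCoeff_fderiv (hf.of_le (by exact_mod_cast le_top)) hp, pow_succ, mul_assoc]
    have h1 : dotZ n (Pi.single i 1) = n i := by simp [dotZ, Pi.single_apply]
    have h2 : ‖(2 * Real.pi * Complex.I * (n i : ℝ) : ℂ)‖ = 2 * Real.pi * ‖n i‖ := by
      simp [abs_of_pos Real.pi_pos, Int.norm_eq_abs]
    rw [h1, norm_mul, h2]
    gcongr
    nlinarith [Real.pi_gt_three, norm_nonneg (n i)]

lemma exists_norm_pow_mul_norm_cubeCoeff_le {d : ℕ} (hd : 1 ≤ d) {f : (Fin d → ℝ) → ℂ}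
    (hf : ContDiff ℝ (⊤ : ℕ∞) f) (hp : ZPeriodic f) (N : ℕ) :
    ∃ C, 0 ≤ C ∧ ∀ n : Fin d → ℤ, ‖n‖ ^ N * ‖cubeCoeff f n‖ ≤ C := by
  choose C hC using fun i => exists_abs_pow_mul_norm_cubeCoeff_le i N f hf hp
  have hpos : ∀ i, 0 ≤ C i := fun i => le_trans (by positivity) (hC i 0)
  refine ⟨∑ i, C i, Finset.sum_nonneg fun i _ => hpos i, fun n => ?_⟩
  have : Nonempty (Fin d) := ⟨⟨0, hd⟩⟩
  obtain ⟨i, hi⟩ := Finite.exists_max fun i => ‖n i‖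
  have hn : ‖n‖ ≤ ‖n i‖ := (pi_norm_le_iff_of_nonneg (norm_nonneg _)).2 hi
  calc ‖n‖ ^ N * ‖cubeCoeff f n‖ ≤ ‖n i‖ ^ N * ‖cubeCoeff f n‖ := by gcongr
    _ ≤ C i := hC i n
    _ ≤ ∑ i, C i := Finset.single_le_sum (fun i _ => hpos i) (Finset.mem_univ i)

lemma one_le_norm_of_ne_zero {d : ℕ} {n : Fin d → ℤ} (hn : n ≠ 0) : 1 ≤ ‖n‖ := by
  obtain ⟨i, hi⟩ := Function.ne_iff.1 hn
  refine le_trans ?_ (norm_le_pi_norm n i)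
  rw [Int.norm_eq_abs]
  exact_mod_cast Int.one_le_abs hi

lemma mFourier_torusMk {d : ℕ} (n : Fin d → ℤ) (x : Fin d → ℝ) :
    mFourier n (torusMk x) = torusChar n x := by
  simp only [mFourier, ContinuousMap.coe_mk, torusMk, fourier_coe_apply, torusChar,
    ← Complex.exp_sum]
  congr 1
  simp [dotZ, Finset.mul_sum]
  exact Finset.sum_congr rfl fun i _ => by ring

lemma mFourierCoeff_torusLift {d : ℕ} {f : (Fin d → ℝ) → ℂ} (hp : ZPeriodic f)
    (n : Fin d → ℤ) : mFourierCoeff (torusLift f) n = cubeCoeff f n := by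
  rw [mFourierCoeff_eq_integral _ _ 0]
  refine integral_congr_ae (.of_forall fun x => ?_)
  change mFourier (-n) (torusMk x) • torusLift f (torusMk x) = _
  rw [mFourier_torusMk, torusLift_torusMk hp, smul_eq_mul]

lemma hasSum_cubeCoeff {d : ℕ} {f : (Fin d → ℝ) → ℂ} (hf : Continuous f) (hp : ZPeriodic f)
    (hs : Summable (cubeCoeff f)) (x : Fin d → ℝ) :
    HasSum (fun n => cubeCoeff f n * torusChar n x) (f x) := by
  let F : C(UnitAddTorus (Fin d), ℂ) := ⟨torusLift f, continuous_torusLift hf hp⟩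
  have hF : ∀ n, mFourierCoeff F n = cubeCoeff f n := mFourierCoeff_torusLift hp
  have h := hasSum_mFourier_series_apply_of_summable (f := F)
    (hs.congr fun n => (hF n).symm) (torusMk x)
  simp only [hF, mFourier_torusMk, smul_eq_mul] at h
  rwa [show F (torusMk x) = f x from torusLift_torusMk hp x] at h

lemma intDist_le (t : ℝ) (m : ℤ) : intDist t ≤ |t - m| :=
  ciInf_le ⟨0, by rintro _ ⟨m, rfl⟩; positivity⟩ m

lemma intDist_le_norm_exp_sub_one (t : ℝ) :
    intDist t ≤ ‖Complex.exp (2 * Real.pi * Complex.I * t) - 1‖ := by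
  set s := t - round t with hs
  have h1 : Complex.exp (2 * Real.pi * Complex.I * t) =
      Complex.exp (Complex.I * ((2 * Real.pi * s : ℝ) : ℂ)) := by
    rw [Complex.exp_eq_exp_iff_exists_int]
    exact ⟨round t, by rw [hs]; push_cast; ring⟩
  have h2 : |s| ≤ 1 / 2 := abs_sub_round t
  have h3 : 2 / Real.pi * |Real.pi * s| ≤ |Real.sin (Real.pi * s)| := by
    refine Real.mul_abs_le_abs_sin ?_
    rw [abs_mul, abs_of_pos Real.pi_pos]
    nlinarith [Real.pi_pos]
  have h4 : 2 / Real.pi * |Real.pi * s| = 2 * |s| := by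
    rw [abs_mul, abs_of_pos Real.pi_pos]
    field_simp
  rw [h1, Complex.norm_exp_I_mul_ofReal_sub_one, show 2 * Real.pi * s / 2 = Real.pi * s by ring,
    norm_mul, Real.norm_eq_abs, Real.norm_eq_abs, abs_two]
  have := intDist_le t (round t)
  rw [← hs] at this
  linarith [abs_nonneg s]

lemma norm_inv_torusChar_sub_one_le {d : ℕ} {γ τ : ℝ} (hγ : 0 < γ) {α : Fin d → ℝ}
    (hα : α ∈ DC d γ τ) {n : Fin d → ℤ} (hn : n ≠ 0) :
    torusChar n α - 1 ≠ 0 ∧ ‖(torusChar n α - 1)⁻¹‖ ≤ γ * ‖n‖ ^ ⌈τ⌉₊ := by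
  have h1 := one_le_norm_of_ne_zero hn
  have h2 : γ⁻¹ * ‖n‖ ^ (-τ) ≤ ‖torusChar n α - 1‖ :=
    (hα n hn).trans (intDist_le_norm_exp_sub_one _)
  have h3 : 0 < γ⁻¹ * ‖n‖ ^ (-τ) := by positivity
  refine ⟨norm_pos_iff.1 (h3.trans_le h2), ?_⟩
  rw [norm_inv]
  refine (inv_anti₀ h3 h2).trans ?_
  rw [mul_inv, inv_inv, Real.rpow_neg (norm_nonneg n), inv_inv, ← Real.rpow_natCast]
  gcongr
  exact Nat.le_ceil τ

/-- A Fourier series with rapidly decaying coefficients is smooth. -/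
lemma contDiff_tsum_torusChar {d : ℕ} {b : (Fin d → ℤ) → ℂ}
    (hb : ∀ k : ℕ, Summable fun n => ‖b n‖ * ‖n‖ ^ k) :
    ContDiff ℝ (⊤ : ℕ∞) fun x => ∑' n, b n * torusChar n x := by
  refine contDiff_tsum (v := fun k n => (2 * Real.pi * d) ^ k * (‖b n‖ * ‖n‖ ^ k))
    (fun n => contDiff_const.mul (contDiff_torusChar n)) (fun k _ => (hb k).mul_left _)
    fun k n x _ => ?_
  have h : iteratedFDeriv ℝ k (fun x => b n * torusChar n x) x =
      b n • iteratedFDeriv ℝ k (torusChar n) x :=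
    iteratedFDeriv_const_smul_apply (a := b n) (contDiff_torusChar n).contDiffAt
  rw [h, norm_smul]
  refine (mul_le_mul_of_nonneg_left (norm_iteratedFDeriv_torusChar_le n k x)
    (norm_nonneg _)).trans_eq (by ring)

/-- The product of rapidly decaying coefficients with a multiplier of polynomial growth is
rapidly decaying. -/
lemma summable_mul_cubeCoeff {d : ℕ} (hd : 1 ≤ d) {f : (Fin d → ℝ) → ℂ}
    (hf : ContDiff ℝ (⊤ : ℕ∞) f) (hp : ZPeriodic f) (h0 : cubeCoeff f 0 = 0)
    {a : (Fin d → ℤ) → ℂ} {A : ℝ} {p : ℕ} (ha : ∀ n ≠ 0, ‖a n‖ ≤ A * ‖n‖ ^ p) (k : ℕ) :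
    Summable fun n => ‖cubeCoeff f n * a n‖ * ‖n‖ ^ k := by
  obtain ⟨N, hN⟩ := summable_norm_inv_pow d
  obtain ⟨C, hC0, hC⟩ := exists_norm_pow_mul_norm_cubeCoeff_le hd hf hp (p + k + N)
  refine Summable.of_nonneg_of_le (fun n => by positivity) (fun n => ?_)
    (hN.mul_left (|A| * C))
  by_cases hn : n = 0
  · subst hn
    rw [h0, zero_mul, norm_zero, zero_mul]
    positivity
  have hpos : 0 < ‖n‖ := norm_pos_iff.2 hn
  have h1 : ‖a n‖ ≤ |A| * ‖n‖ ^ p :=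
    (ha n hn).trans (by gcongr; exact le_abs_self A)
  rw [inv_pow, ← div_eq_mul_inv, le_div_iff₀ (by positivity), norm_mul]
  calc ‖cubeCoeff f n‖ * ‖a n‖ * ‖n‖ ^ k * ‖n‖ ^ N
      ≤ ‖cubeCoeff f n‖ * (|A| * ‖n‖ ^ p) * ‖n‖ ^ k * ‖n‖ ^ N := by gcongr
    _ = |A| * (‖n‖ ^ (p + k + N) * ‖cubeCoeff f n‖) := by ring
    _ ≤ |A| * C := by gcongr; exact hC n

/-- Over a Diophantine rotation `α ∈ DC(γ,τ)`, the cohomological equation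
`φ(x+α) - φ(x) = f(x)` has a smooth `ℤ^d`-periodic solution for every smooth
`ℤ^d`-periodic `f` with zero mean on the unit cube. -/
theorem stmt5 (d : ℕ) (hd : 1 ≤ d) (γ τ : ℝ) (hγ : 0 < γ) (hτ : 0 < τ)
    (α : Fin d → ℝ) (hα : α ∈ DC d γ τ)
    (f : (Fin d → ℝ) → ℂ) (hf : ContDiff ℝ (⊤ : ℕ∞) f)
    (hper : ∀ (x : Fin d → ℝ) (k : Fin d → ℤ), f (x + fun i => (k i : ℝ)) = f x)
    (hmean : (∫ x in Set.Icc (0 : Fin d → ℝ) 1, f x) = 0) :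
    ∃ φ : (Fin d → ℝ) → ℂ, ContDiff ℝ (⊤ : ℕ∞) φ ∧
      (∀ (x : Fin d → ℝ) (k : Fin d → ℤ), φ (x + fun i => (k i : ℝ)) = φ x) ∧
      ∀ x : Fin d → ℝ, φ (x + α) - φ x = f x := by
  have hp : ZPeriodic f := hper
  have h0 : cubeCoeff f 0 = 0 := by
    rw [← hmean, ← setIntegral_congr_set (unitCube_ae_eq_Icc d)]
    simp [cubeCoeff, torusChar, dotZ]
  have hsf : Summable (cubeCoeff f) := by
    refine .of_norm ?_
    simpa using summable_mul_cubeCoeff hd hf hp h0 (a := 1) (A := 1) (p := 0) (by simp) 0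
  let b : (Fin d → ℤ) → ℂ := fun n => cubeCoeff f n * (torusChar n α - 1)⁻¹
  have hb : ∀ k : ℕ, Summable fun n => ‖b n‖ * ‖n‖ ^ k :=
    summable_mul_cubeCoeff hd hf hp h0 fun n hn => (norm_inv_torusChar_sub_one_le hγ hα hn).2
  have hbs : ∀ x, Summable fun n => b n * torusChar n x := fun x =>
    .of_norm (by simpa [norm_torusChar] using hb 0)
  refine ⟨fun x => ∑' n, b n * torusChar n x, contDiff_tsum_torusChar hb, fun x k => ?_,
    fun x => ?_⟩
  · simp only [torusChar_periodic _ x k]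
  · rw [← (hbs (x + α)).tsum_sub (hbs x), ← (hasSum_cubeCoeff hf.continuous hp hsf x).tsum_eq]
    refine tsum_congr fun n => ?_
    by_cases hn : n = 0
    · simp [hn, b, h0]
    · have := (norm_inv_torusChar_sub_one_le hγ hα hn).1
      simp only [b]
      rw [torusChar_add]
      field_simp
end
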